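/- If p is a real polynomial in two variables of total degree at most 7 such that p and both of its first-order partial derivatives ∂_x p and ∂_y p vanish at every point of the boundary of the unit square [0,1]×[0,1], then p = 0. -/

import Mathlib

open MvPolynomial

noncomputable section

/-- A bivariate real polynomial; variable `0` is `x`, variable `1` is `y`. -/
abbrev Poly2 : Type := MvPolynomial (Fin 2) ℝ

/-- Evaluation of a bivariate polynomial at the point `(a, b)`. -/
def ev (p : Poly2) (a b : ℝ) : ℝ := MvPolynomial.eval ![a, b] p

/-- The partial derivative `∂ₓ`. -/
def dX (p : Poly2) : Poly2 := MvPolynomial.pderiv 0 p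

/-- The partial derivative `∂_y`. -/
def dY (p : Poly2) : Poly2 := MvPolynomial.pderiv 1 p

namespace MvPolynomial

variable {σ R : Type*}

/-- Replacing the variable `X i` by a constant `c` changes a polynomial by a multiple of
`X i - C c`. -/
theorem X_sub_C_dvd_sub_aeval_update [DecidableEq σ] [CommRing R] (i : σ) (c : R)
    (q : MvPolynomial σ R) :
    X i - C c ∣ q - aeval (Function.update X i (C c)) q := by
  induction q using MvPolynomial.induction_on with
  | C a => simp [algebraMap_eq]
  | add f g hf hg =>
    rw [map_add, add_sub_add_comm]
    exact dvd_add hf hg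
  | mul_X f j hf =>
    rw [map_mul, aeval_X]
    by_cases hj : j = i
    · subst hj
      rw [Function.update_self, show ∀ g : MvPolynomial σ R, f * X j - g * C c =
        f * (X j - C c) + (f - g) * C c from fun g => by ring]
      exact dvd_add (dvd_mul_left _ _) (hf.mul_right _)
    · rw [Function.update_of_ne hj, ← sub_mul]
      exact hf.mul_right _

/-- A polynomial vanishing on the part of the hyperplane `x i = c` whose remaining coordinates range
over an infinite set is divisible by `X i - C c`. -/
theorem X_sub_C_dvd_of_eval_eq_zero [CommRing R] [IsDomain R] {i : σ} {c : R}
    {S : Set R} (hS : S.Infinite) {q : MvPolynomial σ R}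
    (h : ∀ v : σ → R, v i = c → (∀ j ≠ i, v j ∈ S) → eval v q = 0) : X i - C c ∣ q := by
  classical
  have key : aeval (Function.update X i (C c)) q = 0 := by
    refine funext_set (fun _ => S) (fun _ => hS) fun v hv => ?_
    rw [map_zero, ← h (Function.update v i c) (Function.update_self ..)
      fun j hj => by simpa [hj] using hv j trivial]
    have hcomp : (eval v).comp (aeval (R := R) (Function.update X i (C c))).toRingHom =
        eval (Function.update v i c) := by
      refine ringHom_ext (fun a => by simp) fun j => ?_
      by_cases hj : j = i
      · subst hj; simp
      · simp [hj]
    exact congr($hcomp q)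
  have hdvd := X_sub_C_dvd_sub_aeval_update i c q
  rwa [key, sub_zero] at hdvd

/-- A polynomial vanishing together with its `i`-th partial derivative on the part of the hyperplane
`x i = c` whose remaining coordinates range over an infinite set is divisible by
`(X i - C c) ^ 2`. -/
theorem X_sub_C_sq_dvd_of_eval_pderiv_eq_zero [CommRing R] [IsDomain R] {i : σ} {c : R}
    {S : Set R} (hS : S.Infinite) {q : MvPolynomial σ R}
    (h : ∀ v : σ → R, v i = c → (∀ j ≠ i, v j ∈ S) → eval v q = 0)
    (h' : ∀ v : σ → R, v i = c → (∀ j ≠ i, v j ∈ S) → eval v (pderiv i q) = 0) :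
    (X i - C c) ^ 2 ∣ q := by
  obtain ⟨r, rfl⟩ := X_sub_C_dvd_of_eval_eq_zero hS h
  rw [sq]
  refine mul_dvd_mul_left _ (X_sub_C_dvd_of_eval_eq_zero hS fun v hv hvS => ?_)
  simpa [Derivation.leibniz, hv] using h' v hv hvS

theorem totalDegree_X_sub_C [CommRing R] [Nontrivial R] (i : σ) (c : R) :
    (X i - C c : MvPolynomial σ R).totalDegree = 1 := by
  rw [sub_eq_add_neg, ← C_neg, totalDegree_add_eq_left_of_totalDegree_lt] <;> simp

theorem X_sub_C_ne_zero [CommRing R] [Nontrivial R] (i : σ) (c : R) :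
    (X i - C c : MvPolynomial σ R) ≠ 0 := fun h => by
  simpa [h] using totalDegree_X_sub_C i c

theorem irreducible_X_sub_C {K : Type*} [Field K] (i : σ) (c : K) :
    Irreducible (X i - C c : MvPolynomial σ K) := by
  classical
  refine irreducible_of_totalDegree_eq_one (totalDegree_X_sub_C i c) fun x hx => ?_
  refine isUnit_of_dvd_one ?_
  simpa [coeff_C, Finsupp.single_eq_zero, eq_comm] using hx (Finsupp.single i 1)

theorem isRelPrime_X_sub_C {K : Type*} [Field K] {i j : σ} {a b : K} (h : i ≠ j ∨ a ≠ b) :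
    IsRelPrime (X i - C a : MvPolynomial σ K) (X j - C b) := by
  classical
  rw [(irreducible_X_sub_C i a).isRelPrime_iff_not_dvd]
  rintro ⟨r, hr⟩
  by_cases hij : i = j
  · subst hij
    have := congr(eval (fun _ => a) $hr)
    simp [sub_eq_zero] at this
    simp_all
  · have := congr(eval (Function.update (fun _ => b + 1) i a) $hr)
    simp [Ne.symm hij] at this

end MvPolynomial

/-- a polynomial of total degree at most `7` which vanishes together with both
first-order partial derivatives at every point of the boundary of the unit square is zero. -/
theorem stmt_8
    (p : Poly2) (hp : p.totalDegree ≤ 7)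
    (hbd : ∀ x y : ℝ,
      ((x = 0 ∨ x = 1) ∧ y ∈ Set.Icc (0 : ℝ) 1) ∨
      ((y = 0 ∨ y = 1) ∧ x ∈ Set.Icc (0 : ℝ) 1) →
      ev p x y = 0 ∧ ev (dX p) x y = 0 ∧ ev (dY p) x y = 0) :
    p = 0 := by
  have hS : (Set.Icc (0 : ℝ) 1).Infinite := Set.Icc_infinite one_pos
  have hvec : ∀ v : Fin 2 → ℝ, ![v 0, v 1] = v := fun v => by ext k; fin_cases k <;> rfl
  have hX : ∀ c : ℝ, c = 0 ∨ c = 1 → (X 0 - C c) ^ 2 ∣ p := fun c hc =>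
    have hv : ∀ v : Fin 2 → ℝ, v 0 = c → (∀ j ≠ 0, v j ∈ Set.Icc (0 : ℝ) 1) →
        eval v p = 0 ∧ eval v (pderiv 0 p) = 0 := fun v h0 hj => by
      have := hbd (v 0) (v 1) (.inl ⟨h0 ▸ hc, hj 1 (by decide)⟩)
      simp only [ev, dX, hvec] at this
      exact ⟨this.1, this.2.1⟩
    X_sub_C_sq_dvd_of_eval_pderiv_eq_zero hS (fun v h0 hj => (hv v h0 hj).1)
      fun v h0 hj => (hv v h0 hj).2
  have hY : ∀ c : ℝ, c = 0 ∨ c = 1 → (X 1 - C c) ^ 2 ∣ p := fun c hc =>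
    have hv : ∀ v : Fin 2 → ℝ, v 1 = c → (∀ j ≠ 1, v j ∈ Set.Icc (0 : ℝ) 1) →
        eval v p = 0 ∧ eval v (pderiv 1 p) = 0 := fun v h1 hj => by
      have := hbd (v 0) (v 1) (.inr ⟨h1 ▸ hc, hj 0 (by decide)⟩)
      simp only [ev, dY, hvec] at this
      exact ⟨this.1, this.2.2⟩
    X_sub_C_sq_dvd_of_eval_pderiv_eq_zero hS (fun v h1 hj => (hv v h1 hj).1)
      fun v h1 hj => (hv v h1 hj).2
  have hrel : ∀ {i j : Fin 2} {a b : ℝ}, i ≠ j ∨ a ≠ b →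
      IsRelPrime ((X i - C a : Poly2) ^ 2) ((X j - C b) ^ 2) :=
    fun h => (isRelPrime_X_sub_C h).pow
  have hdvd : ((X 0 - C 0) ^ 2 * (X 0 - C 1) ^ 2) * ((X 1 - C 0) ^ 2 * (X 1 - C 1) ^ 2) ∣ p := by
    refine IsRelPrime.mul_dvd (.mul_left (.mul_right ?_ ?_) (.mul_right ?_ ?_))
      (IsRelPrime.mul_dvd ?_ (hX 0 (.inl rfl)) (hX 1 (.inr rfl)))
      (IsRelPrime.mul_dvd ?_ (hY 0 (.inl rfl)) (hY 1 (.inr rfl)))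
    all_goals exact hrel (by simp)
  by_contra hp0
  have hle := (totalDegree_le_of_dvd_of_isDomain hdvd hp0).trans hp
  have hne : ∀ (i : Fin 2) (c : ℝ), (X i - C c : Poly2) ≠ 0 := X_sub_C_ne_zero
  have hdeg : ∀ (i : Fin 2) (c : ℝ), ((X i - C c : Poly2) ^ 2).totalDegree = 2 := fun i c => by
    rw [sq, totalDegree_mul_of_isDomain (hne i c) (hne i c), totalDegree_X_sub_C]
  have hne2 : ∀ (i : Fin 2) (c : ℝ), (X i - C c : Poly2) ^ 2 ≠ 0 :=
    fun i c => pow_ne_zero 2 (hne i c)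
  rw [totalDegree_mul_of_isDomain (mul_ne_zero (hne2 _ _) (hne2 _ _))
      (mul_ne_zero (hne2 _ _) (hne2 _ _)), totalDegree_mul_of_isDomain (hne2 _ _) (hne2 _ _),
    totalDegree_mul_of_isDomain (hne2 _ _) (hne2 _ _)] at hle
  simp only [hdeg] at hle
  omega
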